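/- Let n ≥ 2, let u ∈ ℝⁿ be unit timelike, and let S be any real n×n matrix. Each of the following conditions is sufficient for S to be minimal with respect to u: (i) θ_uᵀ S θ_u = S or θ_uᵀ S θ_u = −S (S equals its electric part or its magnetic part relative to u); (ii) there exist null vectors ℓ, m with ℓᵀηm = 1 and u = (ℓ − m)/√2 such that ℓᵀSℓ = 0, mᵀSm = 0, and ℓᵀSx = xᵀSℓ = mᵀSx = xᵀSm = 0 for every x ∈ ℝⁿ with ℓᵀηx = mᵀηx = 0 (S has only boost-weight-zero components, i.e., S is of alignment type D). -/

import Mathlib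

open Matrix

noncomputable section

/-- The Minkowski metric `η = diag(-1, 1, …, 1)` on `ℝⁿ`. -/
def eta (n : ℕ) : Matrix (Fin n) (Fin n) ℝ :=
  Matrix.diagonal fun i => if i.val = 0 then (-1 : ℝ) else 1

/-- The Lorentz group `O(1,n-1)`: matrices with `Λᵀ η Λ = η`. -/
def IsLorentz {n : ℕ} (Λ : Matrix (Fin n) (Fin n) ℝ) : Prop :=
  Λᵀ * eta n * Λ = eta n

/-- A null vector: nonzero with `vᵀηv = 0`. -/
def IsNull {n : ℕ} (v : Fin n → ℝ) : Prop :=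
  v ≠ 0 ∧ v ⬝ᵥ (eta n).mulVec v = 0

/-- The reflection `θ_u = I + 2u(ηu)ᵀ` sending `u ↦ -u` and fixing `u^⊥`. -/
def theta {n : ℕ} (u : Fin n → ℝ) : Matrix (Fin n) (Fin n) ℝ :=
  1 + (2 : ℝ) • vecMulVec u ((eta n).mulVec u)

/-- `G_u = η + 2uuᵀ`. -/
def Gmat {n : ℕ} (u : Fin n → ℝ) : Matrix (Fin n) (Fin n) ℝ :=
  eta n + (2 : ℝ) • vecMulVec u u

/-- The Euclidean norm associated with `u` on `n×n` matrices:
`‖A‖_u = √(tr(G_u A G_u Aᵀ))`. -/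
def matNorm {n : ℕ} (u : Fin n → ℝ) (A : Matrix (Fin n) (Fin n) ℝ) : ℝ :=
  Real.sqrt (Matrix.trace (Gmat u * A * Gmat u * Aᵀ))

/-- A matrix `A` (covariant rank-2 tensor) is minimal with respect to `u` if
`‖ΛᵀAΛ‖_u ≥ ‖A‖_u` for every Lorentz `Λ`. -/
def IsMinimalMat {n : ℕ} (u : Fin n → ℝ) (A : Matrix (Fin n) (Fin n) ℝ) : Prop :=
  ∀ Λ : Matrix (Fin n) (Fin n) ℝ, IsLorentz Λ → matNorm u A ≤ matNorm u (Λᵀ * A * Λ)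


section helpers

variable {V : Type*} [AddCommGroup V] [Module ℝ V]

theorem aux_cs (g : V →ₗ[ℝ] V →ₗ[ℝ] ℝ) (hs : ∀ x y, g x y = g y x) (u : V)
    (hpos : ∀ x, g u x = 0 → 0 ≤ g x x) (x y : V) (hx : g u x = 0) (hy : g u y = 0) :
    (g x y) ^ 2 ≤ g x x * g y y := by
  have h : ∀ t : ℝ, 0 ≤ g x x * (t * t) + (2 * g x y) * t + g y y := by
    intro t
    have := hpos (t • x + y) (by simp [hx, hy])
    simp only [map_add, map_smul, LinearMap.add_apply, LinearMap.smul_apply, smul_eq_mul,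
      hs y x] at this
    linarith
  have := discrim_le_zero h
  unfold discrim at this
  nlinarith

theorem aux_key (g : V →ₗ[ℝ] V →ₗ[ℝ] ℝ) (hs : ∀ x y, g x y = g y x) (u : V)
    (hu : g u u = -1)
    (hpos : ∀ x, g u x = 0 → 0 ≤ g x x) (P y : V) (hy : g u y = 0) :
    (g P y) ^ 2 ≤ (g P P + (g u P) ^ 2) * g y y ∧ 0 ≤ g P P + (g u P) ^ 2 := by
  have h0 : g u (P + (g u P) • u) = 0 := by simp [hu]
  have e1 : g (P + (g u P) • u) (P + (g u P) • u) = g P P + (g u P) ^ 2 := by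
    simp only [map_add, map_smul, LinearMap.add_apply, LinearMap.smul_apply, smul_eq_mul, hs P u, hu]
    ring
  have e2 : g (P + (g u P) • u) y = g P y := by
    simp [hy]
  have h1 := aux_cs g hs u hpos _ y h0 hy
  have h2 := hpos _ h0
  rw [e1] at h1 h2
  rw [e2] at h1
  exact ⟨h1, h2⟩

/-- decomposition of `v` along `u`. -/
theorem aux_decomp (g : V →ₗ[ℝ] V →ₗ[ℝ] ℝ) (hs : ∀ x y, g x y = g y x) (u v : V)
    (hu : g u u = -1) (hv : g v v = -1) :
    ∃ (c : ℝ) (y : V), v = c • u + y ∧ g u y = 0 ∧ g y y = c ^ 2 - 1 := by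
  refine ⟨-(g u v), v + (g u v) • u, by simp, by simp [hu], ?_⟩
  simp only [map_add, map_smul, LinearMap.add_apply, LinearMap.smul_apply, smul_eq_mul, hs v u, hu, hv]
  ring

theorem aux_electric (g S : V →ₗ[ℝ] V →ₗ[ℝ] ℝ) (hs : ∀ x y, g x y = g y x) (T T' : V →ₗ[ℝ] V)
    (hT : ∀ x y, g x (T y) = S x y) (hT' : ∀ x y, g x (T' y) = S y x)
    (u v : V) (hu : g u u = -1) (hv : g v v = -1)
    (hpos : ∀ x, g u x = 0 → 0 ≤ g x x)
    (h1 : ∀ x, g u x = 0 → S u x = 0) (h2 : ∀ x, g u x = 0 → S x u = 0) :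
    g (T u) (T u) + g (T' u) (T' u) + 2 * (S u u) ^ 2 ≤
      g (T v) (T v) + g (T' v) (T' v) + 2 * (S v v) ^ 2 := by
  obtain ⟨c, y, rfl, hy, hR⟩ := aux_decomp g hs u v hu hv
  have f1 : g (T u) (T u) = - (S u u) ^ 2 := by
    have := h2 (T u + (S u u) • u) (by simp [hT, hu])
    simp only [map_add, map_smul, LinearMap.add_apply, LinearMap.smul_apply, smul_eq_mul] at this
    rw [hT]; linarith
  have f2 : g (T' u) (T' u) = - (S u u) ^ 2 := by
    have := h1 (T' u + (S u u) • u) (by simp [hT', hu])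
    simp only [map_add, map_smul, smul_eq_mul] at this
    rw [hT']; linarith
  obtain ⟨k1, k1'⟩ := aux_key g hs u hu hpos (T (c • u + y)) y hy
  obtain ⟨k2, k2'⟩ := aux_key g hs u hu hpos (T' (c • u + y)) y hy
  rw [hs _ y, hR] at k1 k2
  rw [hT y, hT u] at k1
  rw [hT u] at k1'
  rw [hT' y, hT' u] at k2
  rw [hT' u] at k2'
  have e1 : S y (c • u + y) = S y y := by simp [h2 y hy]
  have e2 : S (c • u + y) y = S y y := by simp [h1 y hy]
  have e3 : S u (c • u + y) = c * S u u := by simp [h1 y hy]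
  have e4 : S (c • u + y) u = c * S u u := by simp [h2 y hy]
  have e5 : S (c • u + y) (c • u + y) = c ^ 2 * S u u + S y y := by
    simp [h1 y hy, h2 y hy]; ring
  have hR0 := hpos y hy
  rw [hR] at hR0
  rw [e1, e3] at k1
  rw [e2, e4] at k2
  rw [e3] at k1'
  rw [e4] at k2'
  rw [f1, f2, e5]
  have hq : c ^ 2 - 1 = 0 → S y y = 0 := by
    intro h; rw [h] at k1; nlinarith
  generalize g (T (c • u + y)) (T (c • u + y)) = M1 at *
  generalize g (T' (c • u + y)) (T' (c • u + y)) = M2 at *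
  generalize S u u = a at *
  generalize S y y = q at *
  generalize hRR : c ^ 2 - 1 = R at *
  have hc : c ^ 2 = R + 1 := by linarith
  have hm : ∀ z : ℝ, (c * z) ^ 2 = (R + 1) * z ^ 2 := fun z => by rw [mul_pow, hc]
  rw [hm] at k1 k2 k1' k2'
  rw [hc]
  rcases hR0.eq_or_lt with h | h
  · have := hq h.symm
    subst this
    subst h
    nlinarith
  · obtain ⟨b, rfl⟩ : ∃ b, q = R * b := ⟨q / R, by field_simp⟩
    have k3 : R * b ^ 2 ≤ M1 + (R + 1) * a ^ 2 := by
      by_contra! hh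
      nlinarith [mul_lt_mul_of_pos_right hh h]
    have k4 : R * b ^ 2 ≤ M2 + (R + 1) * a ^ 2 := by
      by_contra! hh
      nlinarith [mul_lt_mul_of_pos_right hh h]
    have : 0 ≤ R * (R + 1) * (a + b) ^ 2 := by positivity
    nlinarith

theorem aux_magnetic (g S : V →ₗ[ℝ] V →ₗ[ℝ] ℝ) (hs : ∀ x y, g x y = g y x) (T T' : V →ₗ[ℝ] V)
    (hT : ∀ x y, g x (T y) = S x y) (hT' : ∀ x y, g x (T' y) = S y x)
    (u v : V) (hu : g u u = -1) (hv : g v v = -1)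
    (hpos : ∀ x, g u x = 0 → 0 ≤ g x x)
    (h0 : S u u = 0) (h1 : ∀ x y, g u x = 0 → g u y = 0 → S x y = 0) :
    g (T u) (T u) + g (T' u) (T' u) + 2 * (S u u) ^ 2 ≤
      g (T v) (T v) + g (T' v) (T' v) + 2 * (S v v) ^ 2 := by
  obtain ⟨c, y, rfl, hy, hR⟩ := aux_decomp g hs u v hu hv
  obtain ⟨k1, -⟩ := aux_key g hs u hu hpos (T u) y hy
  obtain ⟨k2, -⟩ := aux_key g hs u hu hpos (T' u) y hy
  rw [hs _ y, hR, hT y, hT u, h0] at k1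
  rw [hs _ y, hR, hT' y, hT' u, h0] at k2
  have a1 : g (T u) (T y) = 0 := by
    rw [hT]; exact h1 _ _ (by rw [hT, h0]) hy
  have a2 : g (T' u) (T' y) = 0 := by
    rw [hT']; exact h1 _ _ hy (by rw [hT', h0])
  have a3 : g (T y) (T y) = - (S u y) ^ 2 := by
    have := h1 (T y + (S u y) • u) y (by simp [hT, hu]) hy
    simp only [map_add, map_smul, LinearMap.add_apply, LinearMap.smul_apply, smul_eq_mul] at this
    rw [hT]; linarith
  have a4 : g (T' y) (T' y) = - (S y u) ^ 2 := by
    have := h1 y (T' y + (S y u) • u) hy (by simp [hT', hu])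
    simp only [map_add, map_smul, smul_eq_mul] at this
    rw [hT']; linarith
  have e1 : g (T (c • u + y)) (T (c • u + y)) = c ^ 2 * g (T u) (T u) - (S u y) ^ 2 := by
    simp only [map_add, map_smul, LinearMap.add_apply, LinearMap.smul_apply, smul_eq_mul, a3, a1,
      hs (T y) (T u)]
    ring
  have e2 : g (T' (c • u + y)) (T' (c • u + y)) = c ^ 2 * g (T' u) (T' u) - (S y u) ^ 2 := by
    simp only [map_add, map_smul, LinearMap.add_apply, LinearMap.smul_apply, smul_eq_mul, a4, a2,
      hs (T' y) (T' u)]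
    ring
  have h3 : S y u ^ 2 + S u y ^ 2 ≤ (g (T u) (T u) + g (T' u) (T' u)) * (c ^ 2 - 1) := by linarith
  rw [e1, e2, h0]
  nlinarith [sq_nonneg (S (c • u + y) (c • u + y))]

theorem aux_real (R a b q M1 M2 : ℝ) (hR0 : 0 ≤ R)
    (k1 : q ^ 2 ≤ (M1 - 2 * (-(1 + R) / 2 * (a * b))) * R)
    (k2 : q ^ 2 ≤ (M2 - 2 * (-(1 + R) / 2 * (a * b))) * R)
    (k1' : 0 ≤ M1 - 2 * (-(1 + R) / 2 * (a * b)))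
    (k2' : 0 ≤ M2 - 2 * (-(1 + R) / 2 * (a * b))) :
    -(a * b) + -(a * b) + 2 * (-(a + b) / 2) ^ 2 ≤
      M1 + M2 + 2 * (-(1 + R) / 2 * (a + b) + q) ^ 2 := by
  rcases hR0.eq_or_lt with hh | hh
  · subst hh
    have : q = 0 := by
      rw [mul_zero] at k1
      exact pow_eq_zero_iff (two_ne_zero) |>.mp (le_antisymm k1 (sq_nonneg q))
    subst this
    linarith
  · obtain ⟨p, rfl⟩ : ∃ p, q = R * p := ⟨q / R, by field_simp⟩
    have k3 : R * p ^ 2 ≤ M1 - 2 * (-(1 + R) / 2 * (a * b)) := by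
      refine le_of_mul_le_mul_right ?_ hh
      linarith
    have k4 : R * p ^ 2 ≤ M2 - 2 * (-(1 + R) / 2 * (a * b)) := by
      refine le_of_mul_le_mul_right ?_ hh
      linarith
    have j1 : 0 ≤ R * (a - b) ^ 2 := by positivity
    have j2 : 0 ≤ R * (1 + R) * (a + b - 2 * p) ^ 2 := by positivity
    linarith

theorem aux_typeD (g S : V →ₗ[ℝ] V →ₗ[ℝ] ℝ) (hs : ∀ x y, g x y = g y x) (T T' : V →ₗ[ℝ] V)
    (hT : ∀ x y, g x (T y) = S x y) (hT' : ∀ x y, g x (T' y) = S y x)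
    (u v l m : V) (hv : g v v = -1)
    (hpos : ∀ x, g u x = 0 → 0 ≤ g x x)
    (hl : g l l = 0) (hm : g m m = 0) (hlm : g l m = 1) (hul : u = (Real.sqrt 2)⁻¹ • (l - m))
    (sl : S l l = 0) (sm : S m m = 0)
    (h : ∀ x, g l x = 0 → g m x = 0 → S l x = 0 ∧ S x l = 0 ∧ S m x = 0 ∧ S x m = 0) :
    g (T u) (T u) + g (T' u) (T' u) + 2 * (S u u) ^ 2 ≤
      g (T v) (T v) + g (T' v) (T' v) + 2 * (S v v) ^ 2 := by
  have hml : g m l = 1 := by rw [hs]; exact hlm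
  have hr : (Real.sqrt 2)⁻¹ * (Real.sqrt 2)⁻¹ = 1 / 2 := by
    rw [← mul_inv, Real.mul_self_sqrt (by norm_num)]; norm_num
  have hu0 : ∀ x, g l x = 0 → g m x = 0 → g u x = 0 := by
    intro x h1 h2; rw [hul]; simp [h1, h2]
  obtain ⟨x, y, z, hvz, hlz, hmz⟩ : ∃ (x y : ℝ) (z : V), v = x • l + y • m + z ∧ g l z = 0 ∧
      g m z = 0 :=
    ⟨g m v, g l v, v - (g m v) • l - (g l v) • m, by abel, by simp [hl, hlm], by simp [hm, hml]⟩
  obtain ⟨z1, z2, z3, z4⟩ := h z hlz hmz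
  have hR : g z z = -1 - 2 * (x * y) := by
    rw [hvz] at hv
    simp only [map_add, map_smul, LinearMap.add_apply, LinearMap.smul_apply, smul_eq_mul, hl, hm,
      hlm, hml, hlz, hmz, hs z l, hs z m] at hv
    linarith
  have cs : ∀ P : V, (g P z) ^ 2 ≤ (g P P - 2 * (g l P * g m P)) * g z z ∧
      0 ≤ g P P - 2 * (g l P * g m P) := by
    intro P
    have p1 : g l (P - (g m P) • l - (g l P) • m) = 0 := by simp [hl, hlm]
    have p2 : g m (P - (g m P) • l - (g l P) • m) = 0 := by simp [hm, hml]
    have p3 := hu0 _ p1 p2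
    have e : g (P - (g m P) • l - (g l P) • m) (P - (g m P) • l - (g l P) • m) =
        g P P - 2 * (g l P * g m P) := by
      simp only [map_sub, map_smul, LinearMap.sub_apply, LinearMap.smul_apply, smul_eq_mul, hl, hm,
        hlm, hml, hs P l, hs P m]
      ring
    have e' : g (P - (g m P) • l - (g l P) • m) z = g P z := by
      simp [hlz, hmz]
    have q1 := aux_cs g hs u hpos _ z p3 (hu0 z hlz hmz)
    have q2 := hpos _ p3
    rw [e, e'] at q1
    rw [e] at q2
    exact ⟨q1, q2⟩
  obtain ⟨k1, k1'⟩ := cs (T v)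
  obtain ⟨k2, k2'⟩ := cs (T' v)
  rw [hs _ z] at k1 k2
  rw [hT z, hT l, hT m] at k1
  rw [hT l, hT m] at k1'
  rw [hT' z, hT' l, hT' m] at k2
  rw [hT' l, hT' m] at k2'
  have e1 : S z v = S z z := by rw [hvz]; simp [z2, z4]
  have e2 : S v z = S z z := by rw [hvz]; simp [z1, z3]
  have e3 : S l v = y * S l m := by rw [hvz]; simp [z1, sl]
  have e4 : S m v = x * S m l := by rw [hvz]; simp [z3, sm]
  have e5 : S v l = y * S m l := by rw [hvz]; simp [z2, sl]
  have e6 : S v m = x * S l m := by rw [hvz]; simp [z4, sm]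
  have e7 : S v v = (x * y) * (S l m + S m l) + S z z := by
    rw [hvz]; simp [z1, z2, z3, z4, sl, sm]; ring
  rw [e1, e3, e4] at k1
  rw [e3, e4] at k1'
  rw [e2, e5, e6] at k2
  rw [e5, e6] at k2'
  have tu : ∀ w x : V, S (T w) x = g (T x) (T w) := fun w x => by rw [hs, hT]
  have t1 : g (T l) (T l) = 0 := by
    have := (h (T l - (S m l) • l) (by simp [hT, hl, sl]) (by simp [hT, hml])).2.1
    rw [hT]; simpa [sl] using this
  have t2 : g (T m) (T m) = 0 := by
    have := (h (T m - (S l m) • m) (by simp [hT, hlm]) (by simp [hT, hm, sm])).2.2.2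
    rw [hT]; simpa [sm] using this
  have t3 : g (T l) (T m) = S l m * S m l := by
    have := (h (T l - (S m l) • l) (by simp [hT, hl, sl]) (by simp [hT, hml])).2.2.2
    rw [hT]
    simp only [map_sub, map_smul, LinearMap.sub_apply, LinearMap.smul_apply, smul_eq_mul] at this
    linarith
  have t1' : g (T' l) (T' l) = 0 := by
    have := (h (T' l - (S l m) • l) (by simp [hT', hl, sl]) (by simp [hT', hml])).1
    rw [hT']; simpa [sl] using this
  have t2' : g (T' m) (T' m) = 0 := by
    have := (h (T' m - (S m l) • m) (by simp [hT', hlm]) (by simp [hT', hm, sm])).2.2.1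
    rw [hT']; simpa [sm] using this
  have t3' : g (T' l) (T' m) = S l m * S m l := by
    have := (h (T' l - (S l m) • l) (by simp [hT', hl, sl]) (by simp [hT', hml])).2.2.1
    rw [hT']
    simp only [map_sub, map_smul, smul_eq_mul] at this
    linarith
  have b1 : g (T u) (T u) = - (S l m * S m l) := by
    rw [hul]
    simp only [map_sub, map_smul, LinearMap.sub_apply, LinearMap.smul_apply, smul_eq_mul, t1, t2,
      t3, hs (T m) (T l)]
    linear_combination (-2 * (S l m * S m l)) * hr
  have b2 : g (T' u) (T' u) = - (S l m * S m l) := by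
    rw [hul]
    simp only [map_sub, map_smul, LinearMap.sub_apply, LinearMap.smul_apply, smul_eq_mul, t1', t2',
      t3', hs (T' m) (T' l)]
    linear_combination (-2 * (S l m * S m l)) * hr
  have b3 : S u u = - (S l m + S m l) / 2 := by
    rw [hul]
    simp only [map_sub, map_smul, LinearMap.sub_apply, LinearMap.smul_apply, smul_eq_mul, sl, sm]
    linear_combination (-(S l m + S m l)) * hr
  have hR0 := hpos z (hu0 z hlz hmz)
  rw [b1, b2, b3, e7]
  generalize g (T v) (T v) = M1 at *
  generalize g (T' v) (T' v) = M2 at *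
  generalize g z z = R at *
  generalize S l m = a at *
  generalize S m l = b at *
  generalize S z z = q at *
  have hxy : x * y = -(1 + R) / 2 := by linarith
  have i1 : y * a * (x * b) = -(1 + R) / 2 * (a * b) := by rw [← hxy]; ring
  have i2 : y * b * (x * a) = -(1 + R) / 2 * (a * b) := by rw [← hxy]; ring
  rw [i1] at k1 k1'
  rw [i2] at k2 k2'
  rw [hxy]
  exact aux_real R a b q M1 M2 hR0 k1 k2 k1' k2'

end helpers

theorem eta_pos {n : ℕ} (hn : 2 ≤ n) (u x : Fin n → ℝ) (hu : u ⬝ᵥ (eta n).mulVec u = -1)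
    (hx : u ⬝ᵥ (eta n).mulVec x = 0) : 0 ≤ x ⬝ᵥ (eta n).mulVec x := by
  obtain ⟨k, rfl⟩ : ∃ k, n = k + 1 := ⟨n - 1, by omega⟩
  have key : ∀ a b : Fin (k+1) → ℝ, a ⬝ᵥ (eta (k+1)).mulVec b =
      - (a 0 * b 0) + ∑ i : Fin k, a i.succ * b i.succ := by
    intro a b
    simp [eta, dotProduct, Matrix.mulVec_diagonal, Fin.sum_univ_succ]
  rw [key] at *
  have cs := Finset.sum_mul_sq_le_sq_mul_sq Finset.univ (fun i : Fin k => u i.succ)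
    (fun i : Fin k => x i.succ)
  simp only [← pow_two] at *
  have hX : 0 ≤ ∑ i : Fin k, x i.succ ^ 2 := Finset.sum_nonneg fun i _ => sq_nonneg _
  have hU : 0 ≤ ∑ i : Fin k, u i.succ ^ 2 := Finset.sum_nonneg fun i _ => sq_nonneg _
  have e : ∑ i : Fin k, u i.succ * x i.succ = u 0 * x 0 := by linarith
  rw [e, mul_pow] at cs
  generalize ∑ i : Fin k, x i.succ ^ 2 = X at *
  generalize ∑ i : Fin k, u i.succ ^ 2 = U at *
  have h1 : u 0 ^ 2 = 1 + U := by linarith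
  rw [h1] at cs
  by_contra! hh
  nlinarith

theorem eta_sq (n : ℕ) : eta n * eta n = 1 := by
  rw [eta, Matrix.diagonal_mul_diagonal, ← Matrix.diagonal_one]
  congr 1
  ext i
  split_ifs <;> norm_num

theorem eta_T (n : ℕ) : (eta n)ᵀ = eta n := by
  simp [eta]

theorem lorentz_T {n : ℕ} {Λ : Matrix (Fin n) (Fin n) ℝ} (h : IsLorentz Λ) :
    Λ * eta n * Λᵀ = eta n := by
  unfold IsLorentz at h
  have h1 : (eta n * Λᵀ * eta n) * Λ = 1 := by
    rw [← eta_sq n]; nth_rewrite 4 [← h]; simp only [Matrix.mul_assoc]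
  have h2 := mul_eq_one_comm.mp h1
  calc Λ * eta n * Λᵀ = Λ * (eta n * Λᵀ * eta n) * eta n := by
        simp only [Matrix.mul_assoc, eta_sq, Matrix.mul_one]
    _ = eta n := by rw [h2, Matrix.one_mul]

theorem trace_vec {n : ℕ} (v : Fin n → ℝ) (A : Matrix (Fin n) (Fin n) ℝ) :
    trace (vecMulVec v v * A) = v ⬝ᵥ A.mulVec v := by
  rw [Matrix.vecMulVec_mul, Matrix.trace_vecMulVec, dotProduct_comm, Matrix.dotProduct_mulVec]

theorem norm_formula {n : ℕ} (v : Fin n → ℝ) (A : Matrix (Fin n) (Fin n) ℝ) :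
    trace (Gmat v * A * Gmat v * Aᵀ) = trace (eta n * A * eta n * Aᵀ) +
      2 * ((v ⬝ᵥ (Aᵀ * eta n * A).mulVec v) + (v ⬝ᵥ (A * eta n * Aᵀ).mulVec v) +
        2 * (v ⬝ᵥ A.mulVec v) ^ 2) := by
  have h1 : trace (vecMulVec v v * A * eta n * Aᵀ) = v ⬝ᵥ (A * eta n * Aᵀ).mulVec v := by
    rw [← trace_vec]; simp only [Matrix.mul_assoc]
  have h2 : trace (eta n * A * vecMulVec v v * Aᵀ) = v ⬝ᵥ (Aᵀ * eta n * A).mulVec v := by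
    rw [← trace_vec, Matrix.mul_assoc, Matrix.trace_mul_comm]; simp only [Matrix.mul_assoc]
  have h3 : trace (vecMulVec v v * A * vecMulVec v v * Aᵀ) = (v ⬝ᵥ A.mulVec v) ^ 2 := by
    have : vecMulVec v v * A * vecMulVec v v = (v ⬝ᵥ A.mulVec v) • vecMulVec v v := by
      rw [Matrix.vecMulVec_mul, Matrix.vecMulVec_mul_vecMulVec, ← Matrix.dotProduct_mulVec]
      ext i j
      simp [vecMulVec_apply]
      try ring
    rw [this, Matrix.smul_mul, Matrix.trace_smul, trace_vec, Matrix.mulVec_transpose,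
      dotProduct_comm v (v ᵥ* A), ← Matrix.dotProduct_mulVec, smul_eq_mul, pow_two]
  simp only [Gmat, Matrix.add_mul, Matrix.mul_add, Matrix.smul_mul, Matrix.mul_smul,
    Matrix.trace_add, Matrix.trace_smul, smul_eq_mul, h1, h2, h3]
  ring

theorem norm_lorentz {n : ℕ} (u : Fin n → ℝ) (A Λ : Matrix (Fin n) (Fin n) ℝ) (h : IsLorentz Λ) :
    trace (Gmat u * (Λᵀ * A * Λ) * Gmat u * (Λᵀ * A * Λ)ᵀ) =
      trace (Gmat (Λ.mulVec u) * A * Gmat (Λ.mulVec u) * Aᵀ) := by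
  have e : Gmat (Λ.mulVec u) = Λ * Gmat u * Λᵀ := by
    unfold Gmat
    rw [Matrix.mul_add, Matrix.add_mul, lorentz_T h, Matrix.mul_smul, Matrix.smul_mul,
      Matrix.mul_vecMulVec, Matrix.vecMulVec_mul, Matrix.vecMul_transpose]
  rw [e]
  simp only [Matrix.transpose_mul, Matrix.transpose_transpose]
  have : Gmat u * (Λᵀ * A * Λ) * Gmat u * (Λᵀ * (Aᵀ * Λ)) =
    (Gmat u * Λᵀ * A * Λ * Gmat u * Λᵀ * Aᵀ) * Λ := by simp only [Matrix.mul_assoc]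
  rw [this, Matrix.trace_mul_comm]
  simp only [Matrix.mul_assoc]

/-- Sufficient conditions for minimality of an arbitrary `n×n` matrix `S` with respect
to a unit timelike `u`: either (i) `S` is a `θ_u`-eigenvector (purely electric or purely
magnetic with respect to `u`), or (ii) `S` has only boost-weight-zero components in a
`u`-adapted null frame (alignment type D). -/
theorem stmt4 {n : ℕ} (hn : 2 ≤ n) (u : Fin n → ℝ)
    (hu : u ⬝ᵥ (eta n).mulVec u = -1)
    (S : Matrix (Fin n) (Fin n) ℝ)
    (h :
      ((theta u)ᵀ * S * theta u = S ∨ (theta u)ᵀ * S * theta u = -S)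
      ∨ (∃ l m : Fin n → ℝ, IsNull l ∧ IsNull m ∧ l ⬝ᵥ (eta n).mulVec m = 1 ∧
          u = (Real.sqrt 2)⁻¹ • (l - m) ∧
          l ⬝ᵥ S.mulVec l = 0 ∧ m ⬝ᵥ S.mulVec m = 0 ∧
          ∀ x : Fin n → ℝ, l ⬝ᵥ (eta n).mulVec x = 0 → m ⬝ᵥ (eta n).mulVec x = 0 →
            l ⬝ᵥ S.mulVec x = 0 ∧ x ⬝ᵥ S.mulVec l = 0 ∧
            m ⬝ᵥ S.mulVec x = 0 ∧ x ⬝ᵥ S.mulVec m = 0)) :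
    IsMinimalMat u S := by
  classical
  intro Λ hΛ
  unfold matNorm
  apply Real.sqrt_le_sqrt
  rw [norm_lorentz u S Λ hΛ, norm_formula, norm_formula]
  set v := Λ.mulVec u with hvdef
  have hv : v ⬝ᵥ (eta n).mulVec v = -1 := by
    have e : ∀ w : Fin n → ℝ, w ⬝ᵥ (Λᵀ * eta n * Λ).mulVec w =
        Λ.mulVec w ⬝ᵥ (eta n).mulVec (Λ.mulVec w) := by
      intro w
      rw [Matrix.mul_assoc, ← Matrix.mulVec_mulVec, Matrix.dotProduct_mulVec,
        Matrix.vecMul_transpose, Matrix.mulVec_mulVec]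
    have hL : Λᵀ * eta n * Λ = eta n := hΛ
    rw [hvdef, ← e, hL, hu]
  let g : (Fin n → ℝ) →ₗ[ℝ] (Fin n → ℝ) →ₗ[ℝ] ℝ := Matrix.toLinearMap₂' ℝ (eta n)
  let B : (Fin n → ℝ) →ₗ[ℝ] (Fin n → ℝ) →ₗ[ℝ] ℝ := Matrix.toLinearMap₂' ℝ S
  have hg : ∀ x y, g x y = x ⬝ᵥ (eta n).mulVec y := fun x y => Matrix.toLinearMap₂'_apply' _ _ _
  have hB : ∀ x y, B x y = x ⬝ᵥ S.mulVec y := fun x y => Matrix.toLinearMap₂'_apply' _ _ _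
  let T := Matrix.toLin' (eta n * S)
  let T' := Matrix.toLin' (eta n * Sᵀ)
  have swap : ∀ (M : Matrix (Fin n) (Fin n) ℝ) (x y : Fin n → ℝ),
      x ⬝ᵥ M.mulVec y = y ⬝ᵥ Mᵀ.mulVec x := by
    intro M x y
    rw [Matrix.dotProduct_mulVec, dotProduct_comm, Matrix.mulVec_transpose]
  have hs : ∀ x y, g x y = g y x := by
    intro x y; rw [hg, hg, swap, eta_T]
  have hT : ∀ x y, g x (T y) = B x y := by
    intro x y
    rw [hg, hB, Matrix.toLin'_apply, Matrix.mulVec_mulVec, ← Matrix.mul_assoc, eta_sq,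
      Matrix.one_mul]
  have hT' : ∀ x y, g x (T' y) = B y x := by
    intro x y
    rw [hg, hB, Matrix.toLin'_apply, Matrix.mulVec_mulVec, ← Matrix.mul_assoc, eta_sq,
      Matrix.one_mul, swap, Matrix.transpose_transpose]
  have hpos : ∀ x, g u x = 0 → 0 ≤ g x x := by
    intro x hx
    rw [hg] at *
    exact eta_pos hn u x hu hx
  have q1 : ∀ w, w ⬝ᵥ (Sᵀ * eta n * S).mulVec w = g (T w) (T w) := by
    intro w
    rw [hT, hB, Matrix.toLin'_apply, Matrix.mul_assoc, ← Matrix.mulVec_mulVec,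
      Matrix.dotProduct_mulVec, Matrix.vecMul_transpose, dotProduct_comm]
  have q2 : ∀ w, w ⬝ᵥ (S * eta n * Sᵀ).mulVec w = g (T' w) (T' w) := by
    intro w
    rw [hT', hB, Matrix.toLin'_apply, Matrix.mulVec_mulVec, Matrix.mul_assoc]
  have hgu : g u u = -1 := by rw [hg, hu]
  have hgv : g v v = -1 := by rw [hg, hv]
  rw [q1, q1, q2, q2, ← hB, ← hB]
  suffices g (T u) (T u) + g (T' u) (T' u) + 2 * (B u u) ^ 2 ≤
      g (T v) (T v) + g (T' v) (T' v) + 2 * (B v v) ^ 2 by linarith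
  have hth : ∀ x y, x ⬝ᵥ ((theta u)ᵀ * S * theta u).mulVec y =
      B (x + (2 * g u x) • u) (y + (2 * g u y) • u) := by
    have h0 : ∀ x, (theta u).mulVec x = x + (2 * g u x) • u := by
      intro x
      rw [theta, Matrix.add_mulVec, Matrix.one_mulVec, Matrix.smul_mulVec,
        Matrix.vecMulVec_mulVec, hs, hg, dotProduct_comm]
      ext i
      simp
      ring
    intro x y
    rw [hB, ← h0, ← h0, Matrix.mul_assoc, ← Matrix.mulVec_mulVec, swap,
      Matrix.transpose_transpose, dotProduct_comm, Matrix.mulVec_mulVec]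
  rcases h with (h | h) | ⟨l, m, hl, hm, hlm, hul, sl, sm, h⟩
  · rw [h] at hth
    simp only [← hB] at hth
    refine aux_electric g B hs T T' hT hT' u v hgu hgv hpos ?_ ?_
    · intro x hx
      have := hth u x
      simp [hx, hgu] at this
      linarith
    · intro x hx
      have := hth x u
      simp [hx, hgu] at this
      linarith
  · rw [h] at hth
    simp only [Matrix.neg_mulVec, dotProduct_neg, ← hB] at hth
    refine aux_magnetic g B hs T T' hT hT' u v hgu hgv hpos ?_ ?_
    · have := hth u u
      simp [hgu] at this
      linarith
    · intro x y hx hy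
      have := hth x y
      simp [hx, hy] at this
      linarith
  · simp only [← hB, ← hg] at h sl sm hlm
    refine aux_typeD g B hs T T' hT hT' u v l m hgv hpos ?_ ?_ hlm hul sl sm h
    · rw [hg]; exact hl.2
    · rw [hg]; exact hm.2

end
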